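/- Let n ≥ 1 be an integer, let p ∈ ℂ with 0 < |p| < 1, and let t, u, v, w, q_1, ..., q_n, z_1, ..., z_n ∈ ℂ, all nonzero, with t u v w ∏_{i=1}^{n} q_i² = 1. Assume θ(z_i²;p) ≠ 0 for all i, and θ(z_i z_j;p) ≠ 0 and θ(z_i/z_j;p) ≠ 0 for all i < j. For nonzero (t',u',v',w') define S(t',u',v',w') := t' θ(u'v';p) θ(u'w';p) θ(v'w';p) · Σ_{σ ∈ {±1}^n} ∏_{i=1}^{n} θ(t' z_i^{σ_i}/q_i;p) θ(u' q_i z_i^{σ_i};p) θ(v' q_i z_i^{σ_i};p) θ(w' q_i z_i^{σ_i};p) / ( z_i^{σ_i} θ(z_i^{2σ_i};p) ) · ∏_{1≤i<j≤n} q_j^{−1} θ(q_i q_j z_i^{σ_i} z_j^{σ_j};p) θ(q_j z_i^{σ_i}/(q_i z_j^{σ_j});p) / ( θ(z_i^{σ_i} z_j^{σ_j};p) θ(z_i^{σ_i}/z_j^{σ_j};p) ). Then for every permutation (t',u',v',w') of (t,u,v,w) one has S(t',u',v',w') = S(t,u,v,w). -/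

import Mathlib

open scoped BigOperators Real

/-- The theta function `θ(x;p)`. -/
noncomputable def ellTheta (x p : ℂ) : ℂ :=
  ∏' k : ℕ, ((1 - p ^ k * x) * (1 - p ^ (k + 1) / x))

/-- `z^{σ}`: `z` if the sign is `+1` (`true`), `z⁻¹` if the sign is `−1` (`false`). -/
noncomputable def pw (z : ℂ) (b : Bool) : ℂ := if b then z else z⁻¹

/-- The symmetrized theta sum `S(t',u',v',w')` of the corollary to "Lemma vanishI". -/
noncomputable def Ssum (n : ℕ) (p : ℂ) (qq z : Fin n → ℂ) (t' u' v' w' : ℂ) : ℂ :=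
  t' * (ellTheta (u' * v') p * ellTheta (u' * w') p * ellTheta (v' * w') p) *
    ∑ σ : Fin n → Bool,
      (∏ i, ellTheta (t' * pw (z i) (σ i) / qq i) p * ellTheta (u' * qq i * pw (z i) (σ i)) p *
          ellTheta (v' * qq i * pw (z i) (σ i)) p * ellTheta (w' * qq i * pw (z i) (σ i)) p /
          (pw (z i) (σ i) * ellTheta (pw (z i) (σ i) ^ 2) p)) *
      ∏ i, ∏ j, if i < j then
        (qq j)⁻¹ * (ellTheta (qq i * qq j * (pw (z i) (σ i) * pw (z j) (σ j))) p *
          ellTheta (qq j * pw (z i) (σ i) / (qq i * pw (z j) (σ j))) p) /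
          (ellTheta (pw (z i) (σ i) * pw (z j) (σ j)) p *
            ellTheta (pw (z i) (σ i) / pw (z j) (σ j)) p)
      else 1

open Filter Topology

section ThetaProduct

lemma ellTheta_factor_sub_one_norm_le (p x : ℂ) (hp1 : ‖p‖ < 1) (k : ℕ) :
    ‖(1 - p ^ k * x) * (1 - p ^ (k + 1) / x) - 1‖ ≤
      ‖p‖ ^ k * (‖x‖ + ‖x⁻¹‖ + ‖x‖ * ‖x⁻¹‖) := by
  have hk : ‖p‖ ^ (k + 1) ≤ ‖p‖ ^ k := pow_le_pow_of_le_one (norm_nonneg _) hp1.le (Nat.le_succ k)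
  have hk1 : ‖p‖ ^ (k + 1) ≤ 1 := pow_le_one₀ (norm_nonneg _) hp1.le
  have h0 : 0 ≤ ‖p‖ ^ k := by positivity
  have e : (1 - p ^ k * x) * (1 - p ^ (k + 1) / x) - 1 =
      -(p ^ k * x) + -(p ^ (k + 1) * x⁻¹) + p ^ k * x * (p ^ (k + 1) * x⁻¹) := by
    rw [div_eq_mul_inv]; ring
  rw [e]
  refine (norm_add₃_le).trans ?_
  simp only [norm_neg, norm_mul, norm_pow]
  have h1 : ‖p‖ ^ (k + 1) * ‖x⁻¹‖ ≤ ‖p‖ ^ k * ‖x⁻¹‖ := by gcongr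
  have h2 : ‖p‖ ^ k * ‖x‖ * (‖p‖ ^ (k + 1) * ‖x⁻¹‖) ≤ ‖p‖ ^ k * ‖x‖ * (1 * ‖x⁻¹‖) := by gcongr
  linarith

lemma summable_ellTheta_factor_sub_one (p x : ℂ) (hp1 : ‖p‖ < 1) :
    Summable fun k : ℕ ↦ ‖(1 - p ^ k * x) * (1 - p ^ (k + 1) / x) - 1‖ :=
  ((summable_geometric_of_lt_one (norm_nonneg p) hp1).mul_right _).of_nonneg_of_le
    (fun _ ↦ norm_nonneg _) (ellTheta_factor_sub_one_norm_le p x hp1)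

lemma multipliable_ellTheta (p x : ℂ) (hp1 : ‖p‖ < 1) :
    Multipliable fun k : ℕ ↦ (1 - p ^ k * x) * (1 - p ^ (k + 1) / x) := by
  simpa using multipliable_one_add_of_summable (summable_ellTheta_factor_sub_one p x hp1)

lemma continuousAt_ellTheta (p : ℂ) (hp1 : ‖p‖ < 1) {x₀ : ℂ} (hx₀ : x₀ ≠ 0) :
    ContinuousAt (fun x ↦ ellTheta x p) x₀ := by
  have hx₀' : 0 < ‖x₀‖ := norm_pos_iff.mpr hx₀
  set K : Set ℂ := {x | ‖x₀‖ / 2 < ‖x‖} ∩ {x | ‖x‖ < 2 * ‖x₀‖}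
  have hK : IsOpen K := (isOpen_lt continuous_const continuous_norm).inter
    (isOpen_lt continuous_norm continuous_const)
  have hK0 : ∀ x ∈ K, x ≠ 0 := fun x hx h ↦ by
    have := hx.1
    simp only [Set.mem_ofPred_eq, h, norm_zero] at this
    linarith
  have hmem : x₀ ∈ K := ⟨by simp only [Set.mem_ofPred_eq]; linarith,
    by simp only [Set.mem_ofPred_eq]; linarith⟩
  have hcts : ∀ k : ℕ, ContinuousOn
      (fun x : ℂ ↦ (1 - p ^ k * x) * (1 - p ^ (k + 1) / x) - 1) K := fun k ↦ by
    fun_prop (disch := assumption)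
  have hprod := Summable.hasProdLocallyUniformlyOn_nat_one_add (K := K)
    (f := fun k x ↦ (1 - p ^ k * x) * (1 - p ^ (k + 1) / x) - 1)
    (u := fun k ↦ ‖p‖ ^ k * (2 * ‖x₀‖ + (‖x₀‖ / 2)⁻¹ + 2 * ‖x₀‖ * (‖x₀‖ / 2)⁻¹)) hK
    ((summable_geometric_of_lt_one (norm_nonneg p) hp1).mul_right _)
    (Eventually.of_forall fun k x hx ↦ (ellTheta_factor_sub_one_norm_le p x hp1 k).trans (by
      have h1 : ‖x‖ ≤ 2 * ‖x₀‖ := le_of_lt hx.2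
      have h2 : ‖x⁻¹‖ ≤ (‖x₀‖ / 2)⁻¹ := by
        rw [norm_inv]
        exact inv_anti₀ (by positivity) (le_of_lt hx.1)
      gcongr)) hcts
  have hc : ContinuousOn (fun x ↦ ellTheta x p) K := by
    have := hprod.tendstoLocallyUniformlyOn_finsetRange.continuousOn
      (Frequently.of_forall fun n ↦ by
        refine continuousOn_finsetProd _ fun i _ ↦ continuousOn_const.add (hcts i))
    simpa [ellTheta] using this
  exact hc.continuousAt (hK.mem_nhds hmem)

lemma exists_zpow_eq_of_ellTheta_eq_zero {p x : ℂ} (hp1 : ‖p‖ < 1) (hx : x ≠ 0)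
    (h : ellTheta x p = 0) : ∃ k : ℤ, x = p ^ k := by
  by_contra! hne
  refine tprod_one_add_ne_zero_of_summable
    (f := fun k : ℕ ↦ (1 - p ^ k * x) * (1 - p ^ (k + 1) / x) - 1) (fun k hk ↦ ?_)
    (summable_ellTheta_factor_sub_one p x hp1) (by simpa [ellTheta] using h)
  rw [add_sub_cancel, mul_eq_zero, sub_eq_zero, sub_eq_zero] at hk
  rcases hk with hk | hk
  · refine hne (-(k : ℤ)) ?_
    rw [zpow_neg, zpow_natCast]
    exact eq_inv_of_mul_eq_one_right hk.symm
  · refine hne ((k + 1 : ℕ) : ℤ) ?_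
    rw [zpow_natCast]
    rw [eq_div_iff hx, one_mul] at hk
    exact hk

/-- Reflection formula `θ(1/x) = -θ(x)/x`. -/
lemma ellTheta_inv {p x : ℂ} (hp1 : ‖p‖ < 1) (hx : x ≠ 0) :
    ellTheta x⁻¹ p = -x⁻¹ * ellTheta x p := by
  have h1 := (multipliable_ellTheta p x hp1).tendsto_prod_tprod_nat
  have h2 := (multipliable_ellTheta p x⁻¹ hp1).tendsto_prod_tprod_nat
  have key : ∀ N : ℕ,
      (∏ k ∈ Finset.range N, ((1 - p ^ k * x⁻¹) * (1 - p ^ (k + 1) / x⁻¹))) *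
        (1 - p ^ N * x⁻¹) =
      -x⁻¹ * (∏ k ∈ Finset.range N, ((1 - p ^ k * x) * (1 - p ^ (k + 1) / x))) *
        (1 - p ^ N * x) := by
    intro N
    induction N with
    | zero => simp only [Finset.range_zero, Finset.prod_empty]; field_simp; ring
    | succ N ih =>
      rw [Finset.prod_range_succ, Finset.prod_range_succ]
      simp only [div_eq_mul_inv, inv_inv] at ih ⊢
      linear_combination (1 - p ^ (N + 1) * x) * (1 - p ^ (N + 1) * x⁻¹) * ih
  have hpow : Tendsto (fun N : ℕ ↦ p ^ N) atTop (𝓝 0) :=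
    tendsto_pow_atTop_nhds_zero_of_norm_lt_one hp1
  have l1 := h1.const_mul (-x⁻¹) |>.mul ((tendsto_const_nhds (x := (1 : ℂ))).sub (hpow.mul_const x))
  have l2 := h2.mul ((tendsto_const_nhds (x := (1 : ℂ))).sub (hpow.mul_const x⁻¹))
  simpa [ellTheta] using tendsto_nhds_unique (l2.congr key) l1

end ThetaProduct

section TripleProduct

/-- The finite Pochhammer symbol `(p;p)_m`. -/
noncomputable def qPoch (p : ℂ) (m : ℕ) : ℂ := ∏ k ∈ Finset.range m, (1 - p ^ (k + 1))

/-- The reciprocal `1/(p;p)_m`, extended by zero to negative `m`. -/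
noncomputable def qPochInv (p : ℂ) (m : ℤ) : ℂ := if m < 0 then 0 else (qPoch p m.toNat)⁻¹

lemma one_sub_pow_succ_ne_zero {p : ℂ} (hp1 : ‖p‖ < 1) (k : ℕ) : 1 - p ^ (k + 1) ≠ 0 := by
  intro h
  have h1 : ‖p ^ (k + 1)‖ < 1 := by
    rw [norm_pow]; exact pow_lt_one₀ (norm_nonneg _) hp1 (Nat.succ_ne_zero k)
  rw [← sub_eq_zero.mp h, norm_one] at h1
  exact lt_irrefl _ h1

lemma qPochInv_eq_mul_succ {p : ℂ} (hp1 : ‖p‖ < 1) (m : ℤ) :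
    qPochInv p m = (1 - p ^ (m + 1)) * qPochInv p (m + 1) := by
  rcases lt_trichotomy m (-1) with h | rfl | h
  · simp [qPochInv, show m < 0 by omega, show m + 1 < 0 by omega]
  · simp [qPochInv]
  · obtain ⟨k, rfl⟩ : ∃ k : ℕ, m = k := ⟨m.toNat, by omega⟩
    have := one_sub_pow_succ_ne_zero hp1 k
    have h2 : ((k : ℤ) + 1).toNat = k + 1 := by omega
    have h3 : ¬ ((k : ℤ) + 1 < 0) := by omega
    have h4 : p ^ ((k : ℤ) + 1) = p ^ (k + 1) := by exact_mod_cast zpow_natCast p (k + 1)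
    simp only [qPochInv, h2, h3, h4, if_false, Int.toNat_natCast, qPoch, Finset.prod_range_succ]
    simp only [show ¬ ((k : ℤ) < 0) by omega, if_false]
    field_simp

lemma exists_tendsto_qPoch {p : ℂ} (hp1 : ‖p‖ < 1) :
    ∃ κ : ℂ, κ ≠ 0 ∧ Tendsto (qPoch p) atTop (𝓝 κ) := by
  have hs : Summable fun k : ℕ ↦ ‖-p ^ (k + 1)‖ := by
    simp only [norm_neg, norm_pow]
    exact (summable_geometric_of_lt_one (norm_nonneg p) hp1).comp_injective (add_left_injective 1)
  have hm := multipliable_one_add_of_summable hs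
  refine ⟨_, tprod_one_add_ne_zero_of_summable (fun k ↦ ?_) hs,
    hm.tendsto_prod_tprod_nat.congr fun N ↦ ?_⟩
  · simpa [sub_eq_add_neg] using one_sub_pow_succ_ne_zero hp1 k
  · simp [qPoch, sub_eq_add_neg]

lemma exists_norm_qPoch_le {p : ℂ} (hp1 : ‖p‖ < 1) : ∃ M, ∀ m, ‖qPoch p m‖ ≤ M := by
  obtain ⟨κ, -, h⟩ := exists_tendsto_qPoch hp1
  obtain ⟨M, hM⟩ := h.norm.bddAbove_range
  exact ⟨M, fun m ↦ hM ⟨m, rfl⟩⟩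

lemma exists_norm_qPochInv_le {p : ℂ} (hp1 : ‖p‖ < 1) :
    ∃ M, 0 ≤ M ∧ ∀ m, ‖qPochInv p m‖ ≤ M := by
  obtain ⟨κ, h0, h⟩ := exists_tendsto_qPoch hp1
  obtain ⟨M, hM⟩ := (h.inv₀ h0).norm.bddAbove_range
  have hM0 : 0 ≤ M := (norm_nonneg _).trans (hM ⟨0, rfl⟩)
  refine ⟨M, hM0, fun m ↦ ?_⟩
  rw [qPochInv]
  split_ifs
  · simpa
  · exact hM ⟨_, rfl⟩

lemma tendsto_qPochInv {p κ : ℂ} (h0 : κ ≠ 0) (h : Tendsto (qPoch p) atTop (𝓝 κ)) :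
    Tendsto (qPochInv p) atTop (𝓝 κ⁻¹) := by
  have h1 : Tendsto (fun m : ℤ ↦ (qPoch p m.toNat)⁻¹) atTop (𝓝 κ⁻¹) :=
    (h.inv₀ h0).comp (tendsto_atTop.mpr fun b ↦ by
      filter_upwards [eventually_ge_atTop (b : ℤ)] with m hm using by omega)
  refine h1.congr' ?_
  filter_upwards [eventually_ge_atTop 0] with m hm
  simp [qPochInv, not_lt.mpr hm]

/-- The coefficients `(-1)^n ρ^(n² - n)` of the theta series. -/
noncomputable def thetaCoeff (ρ : ℂ) (n : ℤ) : ℂ := (-1) ^ n * ρ ^ (n * n - n)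

lemma thetaCoeff_add_one {ρ : ℂ} (hρ : ρ ≠ 0) (n : ℤ) :
    thetaCoeff ρ (n + 1) = -ρ ^ (2 * n) * thetaCoeff ρ n := by
  rw [thetaCoeff, thetaCoeff, zpow_add₀ (by norm_num : (-1 : ℂ) ≠ 0),
    show (n + 1) * (n + 1) - (n + 1) = 2 * n + (n * n - n) by ring, zpow_add₀ hρ]
  ring

lemma hasSum_finite_theta {ρ x : ℂ} (hρ : ρ ≠ 0) (hp1 : ‖ρ ^ 2‖ < 1) (hx : x ≠ 0) (N : ℕ) :
    HasSum (fun n : ℤ ↦ thetaCoeff ρ n * qPoch (ρ ^ 2) (2 * N) * qPochInv (ρ ^ 2) (N - n) *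
        qPochInv (ρ ^ 2) (N + n) * x ^ n)
      (∏ k ∈ Finset.range N, ((1 - (ρ ^ 2) ^ k * x) * (1 - (ρ ^ 2) ^ (k + 1) / x))) := by
  have hp : ρ ^ 2 ≠ 0 := pow_ne_zero _ hρ
  induction N with
  | zero =>
    convert hasSum_single (0 : ℤ) fun n hn ↦ ?_
    · simp [thetaCoeff, qPoch, qPochInv]
    · rcases lt_or_gt_of_ne hn with h | h
      · simp [qPochInv, h]
      · simp [qPochInv, h]
  | succ N ih =>
    have h1 := ih.mul_left (1 + (ρ ^ 2) ^ (2 * N + 1))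
    have h2 := ((Equiv.subRight (1 : ℤ)).hasSum_iff.mpr ih).mul_left ((ρ ^ 2) ^ N * x)
    have h3 := ((Equiv.addRight (1 : ℤ)).hasSum_iff.mpr ih).mul_left ((ρ ^ 2) ^ (N + 1) / x)
    have h := (h1.sub h2).sub h3
    rw [show (1 + (ρ ^ 2) ^ (2 * N + 1)) * (∏ k ∈ Finset.range N, ((1 - (ρ ^ 2) ^ k * x) *
        (1 - (ρ ^ 2) ^ (k + 1) / x))) - (ρ ^ 2) ^ N * x * (∏ k ∈ Finset.range N,
        ((1 - (ρ ^ 2) ^ k * x) * (1 - (ρ ^ 2) ^ (k + 1) / x))) - (ρ ^ 2) ^ (N + 1) / x *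
        (∏ k ∈ Finset.range N, ((1 - (ρ ^ 2) ^ k * x) * (1 - (ρ ^ 2) ^ (k + 1) / x))) =
        ∏ k ∈ Finset.range (N + 1), ((1 - (ρ ^ 2) ^ k * x) * (1 - (ρ ^ 2) ^ (k + 1) / x)) by
      rw [Finset.prod_range_succ, pow_succ _ N, pow_succ _ (2 * N), two_mul, pow_add]
      generalize (ρ ^ 2) ^ N = R
      field_simp
      ring_nf] at h
    refine h.congr_fun fun n ↦ ?_
    have e1 : thetaCoeff ρ n = -ρ ^ (2 * (n - 1)) * thetaCoeff ρ (n - 1) := by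
      simpa using thetaCoeff_add_one hρ (n - 1)
    have i1 := qPochInv_eq_mul_succ hp1 (N - n)
    have i2 := qPochInv_eq_mul_succ hp1 (N + n)
    have i3 := qPochInv_eq_mul_succ hp1 (N + n - 1)
    have i4 := qPochInv_eq_mul_succ hp1 (N - n - 1)
    simp only [sub_add_cancel] at i3 i4
    have hN2 : qPoch (ρ ^ 2) (2 * (N + 1)) = qPoch (ρ ^ 2) (2 * N) *
        (1 - (ρ ^ 2) ^ (2 * N + 1)) * (1 - (ρ ^ 2) ^ (2 * N + 2)) := by
      rw [qPoch, qPoch, show 2 * (N + 1) = 2 * N + 1 + 1 by ring, Finset.prod_range_succ,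
        Finset.prod_range_succ]
    simp only [Function.comp, Equiv.subRight_apply, Equiv.coe_addRight, thetaCoeff_add_one hρ n,
      hN2]
    have f1 : (((N + 1 : ℕ) : ℤ) - n) = N - n + 1 := by push_cast; ring
    have f2 : (((N + 1 : ℕ) : ℤ) + n) = N + n + 1 := by push_cast; ring
    have f3 : ((N : ℤ) - (n - 1)) = N - n + 1 := by ring
    have f4 : ((N : ℤ) + (n - 1)) = N + n - 1 := by ring
    have f5 : ((N : ℤ) - (n + 1)) = N - n - 1 := by ring
    have f6 : ((N : ℤ) + (n + 1)) = N + n + 1 := by ring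
    rw [f1, f2, f3, f4, f5, f6, i3, i4, i1, i2, e1, zpow_sub₀ hx, zpow_add₀ hx]
    have hz : ∀ k : ℤ, (ρ ^ 2) ^ k = (ρ ^ k) ^ 2 := fun k ↦ by
      rw [← zpow_natCast, ← zpow_natCast, ← zpow_mul, ← zpow_mul, mul_comm]
    have hz' : ∀ k : ℤ, ρ ^ (2 * k) = (ρ ^ k) ^ 2 := fun k ↦ by
      rw [← zpow_natCast, ← zpow_mul, mul_comm]; rfl
    rw [zpow_add₀ hp, zpow_add₀ hp, zpow_sub₀ hp, zpow_add₀ hp, hz' (n - 1), hz' n, zpow_sub₀ hρ,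
      hz n, zpow_natCast, zpow_one, zpow_one]
    have hr : ρ ^ n ≠ 0 := zpow_ne_zero _ hρ
    have hxn : x ^ n ≠ 0 := zpow_ne_zero _ hx
    generalize ρ ^ n = r at *
    generalize x ^ n = y at *
    generalize qPochInv (ρ ^ 2) _ = I1
    generalize qPochInv (ρ ^ 2) _ = I2
    simp only [pow_succ (ρ ^ 2), pow_mul' _ 2 N]
    generalize (ρ ^ 2) ^ N = R
    field_simp
    ring

end TripleProduct

section ThetaSeries

lemma summable_nat_gaussian {r y : ℝ} (hr0 : 0 < r) (hr1 : r < 1) (hy : 0 < y) :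
    Summable fun n : ℕ ↦ r ^ (n * n) * y ^ n := by
  refine summable_of_ratio_test_tendsto_lt_one (l := 0) zero_lt_one
    (Eventually.of_forall fun n ↦ by positivity) ?_
  have h : Tendsto (fun n : ℕ ↦ r * y * (r ^ 2) ^ n) atTop (𝓝 0) := by
    simpa using (tendsto_pow_atTop_nhds_zero_of_lt_one (by positivity)
      (pow_lt_one₀ hr0.le hr1 two_ne_zero)).const_mul (r * y)
  refine h.congr fun n ↦ ?_
  rw [Real.norm_of_nonneg (by positivity), Real.norm_of_nonneg (by positivity), eq_div_iff
    (by positivity), ← pow_mul, show (n + 1) * (n + 1) = n * n + 2 * n + 1 by ring]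
  ring

lemma summable_int_gaussian {r y : ℝ} (hr0 : 0 < r) (hr1 : r < 1) (hy : 0 < y) :
    Summable fun n : ℤ ↦ r ^ (n * n) * y ^ n := by
  refine Summable.of_nat_of_neg ((summable_nat_gaussian hr0 hr1 hy).congr fun n ↦ ?_)
    ((summable_nat_gaussian hr0 hr1 (inv_pos.mpr hy)).congr fun n ↦ ?_)
  · rw [← Nat.cast_mul, zpow_natCast, zpow_natCast]
  · rw [neg_mul_neg, ← Nat.cast_mul, zpow_neg, zpow_natCast, zpow_natCast, inv_pow]

lemma summable_norm_thetaCoeff_mul_zpow {ρ x : ℂ} (hρ : ρ ≠ 0) (hρ1 : ‖ρ‖ < 1) (hx : x ≠ 0) :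
    Summable fun n : ℤ ↦ ‖thetaCoeff ρ n * x ^ n‖ := by
  have hρ0 := norm_pos_iff.mpr hρ
  refine (summable_int_gaussian hρ0 hρ1 (y := ‖x‖ / ‖ρ‖)
    (div_pos (norm_pos_iff.mpr hx) hρ0)).congr fun n ↦ ?_
  simp only [thetaCoeff, norm_mul, norm_zpow, norm_neg, norm_one, one_zpow, one_mul]
  rw [zpow_sub₀ hρ0.ne', div_zpow]
  ring

/-- Jacobi's triple product identity, up to the value of the constant. -/
lemma exists_hasSum_ellTheta {ρ : ℂ} (hρ : ρ ≠ 0) (hρ1 : ‖ρ‖ < 1) :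
    ∃ κ : ℂ, κ ≠ 0 ∧ ∀ x : ℂ, x ≠ 0 →
      HasSum (fun n : ℤ ↦ thetaCoeff ρ n * x ^ n) (κ * ellTheta x (ρ ^ 2)) := by
  have hp1 : ‖ρ ^ 2‖ < 1 := by
    rw [norm_pow]; exact pow_lt_one₀ (norm_nonneg _) hρ1 two_ne_zero
  obtain ⟨κ, hκ, hlim⟩ := exists_tendsto_qPoch hp1
  obtain ⟨M, hM⟩ := exists_norm_qPoch_le hp1
  obtain ⟨M', hM'0, hM'⟩ := exists_norm_qPochInv_le hp1
  have hM0 : 0 ≤ M := (norm_nonneg _).trans (hM 0)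
  have hinv := tendsto_qPochInv hκ hlim
  refine ⟨κ, hκ, fun x hx ↦ ?_⟩
  have hsum := summable_norm_thetaCoeff_mul_zpow hρ hρ1 hx
  have hT := tendsto_tsum_of_dominated_convergence (𝓕 := atTop)
    (f := fun (N : ℕ) (n : ℤ) ↦ thetaCoeff ρ n * qPoch (ρ ^ 2) (2 * N) *
      qPochInv (ρ ^ 2) (N - n) * qPochInv (ρ ^ 2) (N + n) * x ^ n)
    (g := fun n ↦ thetaCoeff ρ n * κ * κ⁻¹ * κ⁻¹ * x ^ n)
    (hsum.mul_left (M * M' * M')) (fun n ↦ by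
      have hN : Tendsto (fun N : ℕ ↦ (N : ℤ)) atTop atTop := tendsto_natCast_atTop_atTop
      exact (((tendsto_const_nhds.mul (hlim.comp
        (tendsto_id.const_mul_atTop' two_pos))).mul (hinv.comp
        (tendsto_atTop_add_const_right _ (-n) hN))).mul (hinv.comp
        (tendsto_atTop_add_const_right _ n hN))).mul tendsto_const_nhds)
    (Eventually.of_forall fun N n ↦ by
      rw [show thetaCoeff ρ n * qPoch (ρ ^ 2) (2 * N) * qPochInv (ρ ^ 2) (N - n) *
          qPochInv (ρ ^ 2) (N + n) * x ^ n = qPoch (ρ ^ 2) (2 * N) * qPochInv (ρ ^ 2) (N - n) *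
          qPochInv (ρ ^ 2) (N + n) * (thetaCoeff ρ n * x ^ n) by ring, norm_mul _ (_ * _),
          norm_mul, norm_mul]
      gcongr
      · exact hM _
      · exact hM' _
      · exact hM' _)
  have hP := (multipliable_ellTheta (ρ ^ 2) x hp1).tendsto_prod_tprod_nat
  have heq := tendsto_nhds_unique hP
    (hT.congr fun N ↦ (hasSum_finite_theta hρ hp1 hx N).tsum_eq)
  have : κ * ellTheta x (ρ ^ 2) = ∑' n : ℤ, thetaCoeff ρ n * x ^ n := by
    rw [ellTheta, heq, ← tsum_mul_left]
    refine tsum_congr fun n ↦ ?_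
    field_simp
  rw [this]
  exact hsum.of_norm.hasSum

lemma hasSum_mul_of_summable_norm {f g : ℤ → ℂ} {a b : ℂ} (hf : Summable fun s ↦ ‖f s‖)
    (hg : Summable fun s ↦ ‖g s‖) (ha : HasSum f a) (hb : HasSum g b) :
    HasSum (fun i : ℤ × ℤ ↦ f i.1 * g i.2) (a * b) :=
  ha.mul hb (summable_mul_of_summable_norm hf hg)

/-- Splitting `ℤ × ℤ` according to the parity of `m - k`. -/
noncomputable def parityEquiv : (ℤ × ℤ) ⊕ (ℤ × ℤ) ≃ ℤ × ℤ :=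
  Equiv.ofBijective
    (Sum.elim (fun a ↦ (a.1 + a.2, a.1 - a.2)) (fun a ↦ (a.1 + a.2 + 1, a.1 - a.2))) <| by
  constructor
  · rintro (⟨a, b⟩ | ⟨a, b⟩) (⟨c, d⟩ | ⟨c, d⟩) h <;>
      simp only [Sum.elim_inl, Sum.elim_inr, Prod.mk.injEq, Sum.inl.injEq, Sum.inr.injEq,
        reduceCtorEq] at h ⊢ <;> omega
  · rintro ⟨m, k⟩
    rcases Int.even_or_odd' (m - k) with ⟨c, hc | hc⟩
    · exact ⟨Sum.inl (m - c, c), by simp only [Sum.elim_inl, Prod.mk.injEq]; omega⟩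
    · exact ⟨Sum.inr (m - c - 1, c), by simp only [Sum.elim_inr, Prod.mk.injEq]; omega⟩

lemma hasSum_of_parity {f g : ℤ → ℂ} {a b : ℂ}
    (ha : HasSum (fun i : ℤ × ℤ ↦ f (i.1 + i.2) * g (i.1 - i.2)) a)
    (hb : HasSum (fun i : ℤ × ℤ ↦ f (i.1 + i.2 + 1) * g (i.1 - i.2)) b) :
    HasSum (fun i : ℤ × ℤ ↦ f i.1 * g i.2) (a + b) :=
  parityEquiv.hasSum_iff.mp
    (HasSum.sum (f := (fun i : ℤ × ℤ ↦ f i.1 * g i.2) ∘ parityEquiv) ha hb)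

/-- The series `∑ ρ^(2s²) y^(2s)`. -/
noncomputable def thetaEven (ρ y : ℂ) : ℂ := ∑' s : ℤ, ρ ^ (2 * s * s) * y ^ (2 * s)

/-- The series `∑ ρ^(2s² + 2s) y^(2s + 1)`. -/
noncomputable def thetaOdd (ρ y : ℂ) : ℂ := ∑' s : ℤ, ρ ^ (2 * s * s + 2 * s) * y ^ (2 * s + 1)

lemma summable_thetaEven {ρ y : ℂ} (hρ : ρ ≠ 0) (hρ1 : ‖ρ‖ < 1) (hy : y ≠ 0) :
    Summable fun s : ℤ ↦ ‖ρ ^ (2 * s * s) * y ^ (2 * s)‖ := by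
  have hnorm : 0 < ‖ρ‖ ^ 2 := by positivity
  have hnorm1 : ‖ρ‖ ^ 2 < 1 := pow_lt_one₀ (norm_nonneg _) hρ1 two_ne_zero
  refine (summable_int_gaussian hnorm hnorm1 (y := ‖y‖ ^ 2) (by positivity)).congr fun s ↦ ?_
  rw [norm_mul, norm_zpow, norm_zpow, mul_assoc 2 s s, zpow_mul _ 2 (s * s), zpow_mul _ 2 s]
  rfl

lemma summable_thetaOdd {ρ y : ℂ} (hρ : ρ ≠ 0) (hρ1 : ‖ρ‖ < 1) (hy : y ≠ 0) :
    Summable fun s : ℤ ↦ ‖ρ ^ (2 * s * s + 2 * s) * y ^ (2 * s + 1)‖ := by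
  refine ((summable_thetaEven hρ hρ1 (mul_ne_zero hρ hy)).mul_left ‖y‖).congr fun s ↦ ?_
  rw [← norm_mul, zpow_add₀ hρ, zpow_add₀ hy, mul_zpow, zpow_one]
  congr 1
  ring

lemma hasSum_thetaEven {ρ y : ℂ} (hρ : ρ ≠ 0) (hρ1 : ‖ρ‖ < 1) (hy : y ≠ 0) :
    HasSum (fun s : ℤ ↦ ρ ^ (2 * s * s) * y ^ (2 * s)) (thetaEven ρ y) :=
  (summable_thetaEven hρ hρ1 hy).of_norm.hasSum

lemma hasSum_thetaOdd {ρ y : ℂ} (hρ : ρ ≠ 0) (hρ1 : ‖ρ‖ < 1) (hy : y ≠ 0) :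
    HasSum (fun s : ℤ ↦ ρ ^ (2 * s * s + 2 * s) * y ^ (2 * s + 1)) (thetaOdd ρ y) :=
  (summable_thetaOdd hρ hρ1 hy).of_norm.hasSum

lemma thetaOdd_term_shift {ρ x : ℂ} (hx : x ≠ 0) (s : ℤ) :
    ρ ^ (2 * s * s - 2 * s) * x ^ (2 * s) =
      x * (ρ ^ (2 * (s - 1) * (s - 1) + 2 * (s - 1)) * x ^ (2 * (s - 1) + 1)) := by
  rw [show 2 * (s - 1) * (s - 1) + 2 * (s - 1) = 2 * s * s - 2 * s by ring,
    show 2 * (s - 1) + 1 = 2 * s - 1 by ring, zpow_sub₀ hx (2 * s), zpow_one]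
  field_simp

lemma hasSum_even_part {ρ x y : ℂ} (hρ : ρ ≠ 0) (hρ1 : ‖ρ‖ < 1) (hx : x ≠ 0) (hy : y ≠ 0) :
    HasSum (fun a : ℤ × ℤ ↦ (ρ ^ (2 * a.1 * a.1 - 2 * a.1) * x ^ (2 * a.1)) *
      (ρ ^ (2 * a.2 * a.2) * y ^ (2 * a.2))) (x * thetaOdd ρ x * thetaEven ρ y) := by
  have hs := (((Equiv.subRight (1 : ℤ)).summable_iff.mpr
    (summable_thetaOdd hρ hρ1 hx)).mul_left ‖x‖).congr (g := fun s : ℤ ↦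
      ‖ρ ^ (2 * s * s - 2 * s) * x ^ (2 * s)‖) fun s ↦ by
    rw [thetaOdd_term_shift hx, norm_mul x]; rfl
  have hO : HasSum (fun s : ℤ ↦ ρ ^ (2 * s * s - 2 * s) * x ^ (2 * s)) (x * thetaOdd ρ x) := by
    have h := ((Equiv.subRight (1 : ℤ)).hasSum_iff.mpr (hasSum_thetaOdd hρ hρ1 hx)).mul_left x
    exact h.congr_fun fun s ↦ thetaOdd_term_shift hx s
  exact hasSum_mul_of_summable_norm (f := fun s : ℤ ↦ ρ ^ (2 * s * s - 2 * s) * x ^ (2 * s))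
    (g := fun s : ℤ ↦ ρ ^ (2 * s * s) * y ^ (2 * s)) hs (summable_thetaEven hρ hρ1 hy) hO
    (hasSum_thetaEven hρ hρ1 hy)

lemma hasSum_odd_part {ρ x y : ℂ} (hρ : ρ ≠ 0) (hρ1 : ‖ρ‖ < 1) (hx : x ≠ 0) (hy : y ≠ 0) :
    HasSum (fun a : ℤ × ℤ ↦ (ρ ^ (2 * a.1 * a.1) * x ^ (2 * a.1)) *
      (ρ ^ (2 * a.2 * a.2 + 2 * a.2) * y ^ (2 * a.2 + 1))) (thetaEven ρ x * thetaOdd ρ y) :=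
  hasSum_mul_of_summable_norm (f := fun s : ℤ ↦ ρ ^ (2 * s * s) * x ^ (2 * s))
    (g := fun s : ℤ ↦ ρ ^ (2 * s * s + 2 * s) * y ^ (2 * s + 1)) (summable_thetaEven hρ hρ1 hx)
    (summable_thetaOdd hρ hρ1 hy) (hasSum_thetaEven hρ hρ1 hx) (hasSum_thetaOdd hρ hρ1 hy)

lemma thetaCoeff_mul_even {ρ x y : ℂ} (hρ : ρ ≠ 0) (hx : x ≠ 0) (hy : y ≠ 0) (a b : ℤ) :
    (thetaCoeff ρ (a + b) * (x * y) ^ (a + b)) * (thetaCoeff ρ (a - b) * (x / y) ^ (a - b)) =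
      (ρ ^ (2 * a * a - 2 * a) * x ^ (2 * a)) * (ρ ^ (2 * b * b) * y ^ (2 * b)) := by
  have hneg : (-1 : ℂ) ^ (a + b) * (-1) ^ (a - b) = 1 := by
    rw [← zpow_add₀ (by norm_num), show a + b + (a - b) = 2 * a by ring, zpow_mul]
    norm_num
  have h1 : ρ ^ ((a + b) * (a + b) - (a + b)) * ρ ^ ((a - b) * (a - b) - (a - b)) =
      ρ ^ (2 * a * a - 2 * a) * ρ ^ (2 * b * b) := by
    rw [← zpow_add₀ hρ, ← zpow_add₀ hρ]
    congr 1; ring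
  have h2 : x ^ (a + b) * x ^ (a - b) = x ^ (2 * a) := by
    rw [← zpow_add₀ hx]; congr 1; ring
  have h3 : y ^ (a + b) * (y ^ (a - b))⁻¹ = y ^ (2 * b) := by
    rw [← zpow_neg, ← zpow_add₀ hy]; congr 1; ring
  simp only [thetaCoeff, mul_zpow, div_eq_mul_inv, inv_zpow]
  linear_combination (x ^ (a + b) * x ^ (a - b) * (y ^ (a + b) * (y ^ (a - b))⁻¹)) *
    (ρ ^ ((a + b) * (a + b) - (a + b)) * ρ ^ ((a - b) * (a - b) - (a - b))) * hneg +
    (x ^ (a + b) * x ^ (a - b) * (y ^ (a + b) * (y ^ (a - b))⁻¹)) * h1 +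
    ρ ^ (2 * a * a - 2 * a) * ρ ^ (2 * b * b) * (y ^ (a + b) * (y ^ (a - b))⁻¹) * h2 +
    ρ ^ (2 * a * a - 2 * a) * ρ ^ (2 * b * b) * x ^ (2 * a) * h3

lemma thetaCoeff_mul_odd {ρ x y : ℂ} (hρ : ρ ≠ 0) (hx : x ≠ 0) (hy : y ≠ 0) (a b : ℤ) :
    (thetaCoeff ρ (a + b + 1) * (x * y) ^ (a + b + 1)) *
        (thetaCoeff ρ (a - b) * (x / y) ^ (a - b)) =
      -x * ((ρ ^ (2 * a * a) * x ^ (2 * a)) * (ρ ^ (2 * b * b + 2 * b) * y ^ (2 * b + 1))) := by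
  have h := thetaCoeff_mul_even hρ hx hy a b
  rw [thetaCoeff_add_one hρ, zpow_add₀ (mul_ne_zero hx hy) (a + b) 1, zpow_one,
    zpow_add₀ hy (2 * b) 1, zpow_one]
  have e1 : ρ ^ (2 * (a + b)) * ρ ^ (2 * a * a - 2 * a) * ρ ^ (2 * b * b) =
      ρ ^ (2 * a * a) * ρ ^ (2 * b * b + 2 * b) := by
    rw [← zpow_add₀ hρ, ← zpow_add₀ hρ, ← zpow_add₀ hρ]
    congr 1; ring
  linear_combination -ρ ^ (2 * (a + b)) * (x * y) * h -
    x ^ (2 * a) * y ^ (2 * b) * (x * y) * e1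

/-- `θ(xy)θ(x/y)/x` is a determinant of two functions of one variable. -/
lemma exists_ellTheta_mul_eq {p : ℂ} (hp0 : p ≠ 0) (hp1 : ‖p‖ < 1) :
    ∃ (κ : ℂ) (E O : ℂ → ℂ), κ ≠ 0 ∧ ∀ x y : ℂ, x ≠ 0 → y ≠ 0 →
      κ * (ellTheta (x * y) p * ellTheta (x / y) p) = x * (O x * E y - E x * O y) := by
  obtain ⟨ρ, rfl⟩ : ∃ ρ : ℂ, p = ρ ^ 2 :=
    ⟨_, (IsAlgClosed.exists_pow_nat_eq p two_pos).choose_spec.symm⟩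
  have hρ : ρ ≠ 0 := by rintro rfl; simp at hp0
  have hρ1 : ‖ρ‖ < 1 := by
    rw [norm_pow] at hp1
    exact (pow_lt_one_iff_of_nonneg (norm_nonneg _) two_ne_zero).mp hp1
  obtain ⟨κ, hκ, hsum⟩ := exists_hasSum_ellTheta hρ hρ1
  refine ⟨κ ^ 2, thetaEven ρ, thetaOdd ρ, pow_ne_zero _ hκ, fun x y hx hy ↦ ?_⟩
  have hprod := hasSum_mul_of_summable_norm
    (summable_norm_thetaCoeff_mul_zpow hρ hρ1 (mul_ne_zero hx hy))
    (summable_norm_thetaCoeff_mul_zpow hρ hρ1 (div_ne_zero hx hy))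
    (hsum (x * y) (mul_ne_zero hx hy)) (hsum (x / y) (div_ne_zero hx hy))
  have hboth := hasSum_of_parity (f := fun n ↦ thetaCoeff ρ n * (x * y) ^ n)
    (g := fun n ↦ thetaCoeff ρ n * (x / y) ^ n)
    ((hasSum_even_part hρ hρ1 hx hy).congr_fun fun a ↦ thetaCoeff_mul_even hρ hx hy a.1 a.2)
    (((hasSum_odd_part hρ hρ1 hx hy).mul_left (-x)).congr_fun fun a ↦
      thetaCoeff_mul_odd hρ hx hy a.1 a.2)
  have := hprod.unique hboth
  linear_combination this

end ThetaSeries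

section Genericity

lemma ellTheta_one {p : ℂ} (hp1 : ‖p‖ < 1) : ellTheta 1 p = 0 := by
  have h := ellTheta_inv hp1 (one_ne_zero (α := ℂ))
  rw [inv_one] at h
  linear_combination (1 / 2) * h

lemma ellTheta_inv_ne_zero {p x : ℂ} (hp1 : ‖p‖ < 1) (hx : x ≠ 0) (h : ellTheta x p ≠ 0) :
    ellTheta x⁻¹ p ≠ 0 := by
  rw [ellTheta_inv hp1 hx]
  exact mul_ne_zero (neg_ne_zero.mpr (inv_ne_zero hx)) h

lemma continuous_ellTheta_comp {p : ℂ} (hp1 : ‖p‖ < 1) {g : ℝ → ℂ} (hg : Continuous g)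
    (h0 : ∀ r, g r ≠ 0) : Continuous fun r ↦ ellTheta (g r) p :=
  continuous_iff_continuousAt.mpr fun r ↦
    ContinuousAt.comp (f := g) (continuousAt_ellTheta p hp1 (h0 r)) hg.continuousAt

lemma countable_ellTheta_eq_zero {p c : ℂ} {m : ℝ} (hp1 : ‖p‖ < 1) (hc : c ≠ 0)
    (h : m ≠ 0 ∨ ellTheta c p ≠ 0) :
    {r : ℝ | ellTheta (c * (Real.exp (m * r) : ℂ)) p = 0}.Countable := by
  by_cases hm : m = 0
  · have hθ := h.resolve_left (not_not.mpr hm)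
    convert Set.countable_empty
    ext r
    simp [hm, hθ]
  · have hsub : {r : ℝ | ellTheta (c * (Real.exp (m * r) : ℂ)) p = 0} ⊆
        ⋃ k : ℤ, {r : ℝ | c * (Real.exp (m * r) : ℂ) = p ^ k} := fun r hr ↦
      Set.mem_iUnion.mpr (exists_zpow_eq_of_ellTheta_eq_zero hp1
        (mul_ne_zero hc (by exact_mod_cast (Real.exp_pos _).ne')) hr)
    refine (Set.countable_iUnion fun k ↦ Set.Subsingleton.countable ?_).mono hsub
    intro r hr s hs
    have h1 : c * (Real.exp (m * r) : ℂ) = c * (Real.exp (m * s) : ℂ) := hr.trans hs.symm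
    exact mul_left_cancel₀ hm (Real.exp_injective (Complex.ofReal_injective
      (mul_left_cancel₀ hc h1)))

/-- A continuous function of a deformation parameter vanishes if it does so generically. -/
lemma eq_zero_of_generic {p : ℂ} (hp1 : ‖p‖ < 1) {K : Type*} [Countable K] (c : K → ℂ)
    (m : K → ℝ) (hc : ∀ k, c k ≠ 0) (hm : ∀ k, m k ≠ 0 ∨ ellTheta (c k) p ≠ 0)
    {F : ℝ → ℂ} (hF : Continuous F)
    (h : ∀ r : ℝ, (∀ k, ellTheta (c k * (Real.exp (m k * r) : ℂ)) p ≠ 0) → F r = 0) :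
    F 0 = 0 := by
  have hcount : (⋃ k, {r : ℝ | ellTheta (c k * (Real.exp (m k * r) : ℂ)) p = 0}).Countable :=
    Set.countable_iUnion fun k ↦ countable_ellTheta_eq_zero hp1 (hc k) (hm k)
  have hdense := hcount.dense_compl ℝ
  have hclosed : IsClosed {r | F r = 0} := isClosed_eq hF continuous_const
  have huniv := (hclosed.closure_subset_iff (s := (⋃ k, {r : ℝ |
    ellTheta (c k * (Real.exp (m k * r) : ℂ)) p = 0})ᶜ)).mpr fun r hr ↦ h r fun k hk ↦
      hr (Set.mem_iUnion.mpr ⟨k, hk⟩)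
  exact huniv (hdense 0)

end Genericity

section BinaryForms

/-- A sum of products of linear forms in two variables vanishes identically as soon as it vanishes
at sufficiently many pairwise non-proportional points. -/
lemma sum_prod_linear_eq_zero {ι S K : Type*} [Fintype ι] [Fintype S] [Fintype K] [Nontrivial K]
    (hcard : Fintype.card ι < Fintype.card K) (C : S → ℂ) (A B : S → ι → ℂ) (u v : K → ℂ)
    (hdet : ∀ k l, k ≠ l → u k * v l - u l * v k ≠ 0)
    (hz : ∀ k, ∑ s, C s * ∏ i, (A s i * u k + B s i * v k) = 0) (e o : ℂ) :
    ∑ s, C s * ∏ i, (A s i * e + B s i * o) = 0 := by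
  classical
  have hscale : ∀ (ρ : ℂ) (k : K),
      ∑ s, C s * ∏ i, (A s i * (u k * ρ) + B s i * (v k * ρ)) = 0 := by
    intro ρ k
    have : ∀ s, C s * ∏ i, (A s i * (u k * ρ) + B s i * (v k * ρ)) =
        C s * (∏ i, (A s i * u k + B s i * v k)) * ρ ^ Fintype.card ι := by
      intro s
      rw [mul_assoc, ← Finset.card_univ, ← Finset.prod_const, ← Finset.prod_mul_distrib]
      congr 1
      exact Finset.prod_congr rfl fun i _ ↦ by ring
    simp_rw [this]
    rw [← Finset.sum_mul, hz k, zero_mul]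
  by_cases heo : e = 0 ∧ o = 0
  · obtain ⟨k⟩ := (inferInstance : Nonempty K)
    simpa [heo.1, heo.2] using hscale 0 k
  obtain ⟨μ, hμ⟩ := Infinite.exists_notMem_finset
    (insert (o / e) (Finset.univ.image fun k ↦ v k / u k))
  rw [Finset.mem_insert, not_or] at hμ
  have hd : ∀ k, v k - μ * u k ≠ 0 := by
    intro k hk
    by_cases hu : u k = 0
    · obtain ⟨l, hl⟩ := exists_ne k
      refine hdet l k hl ?_
      have hv : v k = 0 := by simpa [hu] using hk
      rw [hu, hv]; ring
    · refine hμ.2 (Finset.mem_image.mpr ⟨k, Finset.mem_univ _, ?_⟩)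
      rw [div_eq_iff hu]
      linear_combination hk
  have hn : o - e * μ ≠ 0 := by
    intro h
    by_cases he : e = 0
    · exact heo ⟨he, by simpa [he] using h⟩
    · exact hμ.1 (by rw [eq_div_iff he]; linear_combination -h)
  set lam : K → ℂ := fun k ↦ (o * u k - e * v k) / (v k - μ * u k)
  set ρ : K → ℂ := fun k ↦ (o - e * μ) / (v k - μ * u k)
  have hρ : ∀ k, ρ k ≠ 0 := fun k ↦ div_ne_zero hn (hd k)
  have h1 : ∀ k, e + lam k = u k * ρ k := fun k ↦ by
    simp only [lam, ρ]
    rw [← mul_div_assoc, eq_div_iff (hd k), add_mul, div_mul_cancel₀ _ (hd k)]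
    ring
  have h2 : ∀ k, o + lam k * μ = v k * ρ k := fun k ↦ by
    simp only [lam, ρ]
    rw [← mul_div_assoc, eq_div_iff (hd k), add_mul, mul_right_comm, div_mul_cancel₀ _ (hd k)]
    ring
  have hinj : Function.Injective lam := by
    intro k l hkl
    by_contra hne
    have e1 := h1 k
    have e2 := h2 k
    rw [hkl] at e1 e2
    refine mul_ne_zero (mul_ne_zero (hρ k) (hρ l)) (hdet k l hne) ?_
    linear_combination (v l * ρ l) * (h1 l - e1) - (u l * ρ l) * (h2 l - e2)
  let Q : Polynomial ℂ := ∑ s, Polynomial.C (C s) * ∏ i,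
    (Polynomial.C (A s i + B s i * μ) * Polynomial.X + Polynomial.C (A s i * e + B s i * o))
  have hQ : ∀ x, Q.eval x = ∑ s, C s * ∏ i, (A s i * (e + x) + B s i * (o + x * μ)) := by
    intro x
    simp only [Q, Polynomial.eval_finsetSum, Polynomial.eval_mul, Polynomial.eval_C,
      Polynomial.eval_prod, Polynomial.eval_add, Polynomial.eval_X]
    refine Finset.sum_congr rfl fun s _ ↦ ?_
    congr 1
    exact Finset.prod_congr rfl fun i _ ↦ by ring
  have hdeg : Q.natDegree ≤ Fintype.card ι := by
    refine Polynomial.natDegree_sum_le_of_forall_le _ _ fun s _ ↦ ?_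
    refine (Polynomial.natDegree_C_mul_le _ _).trans ((Polynomial.natDegree_prod_le _ _).trans ?_)
    refine (Finset.sum_le_card_nsmul _ _ 1 fun i _ ↦ Polynomial.natDegree_linear_le).trans ?_
    simp
  have hQ0 : Q = 0 := Polynomial.eq_zero_of_natDegree_lt_card_of_eval_eq_zero Q hinj
    (fun k ↦ by rw [hQ, h1, h2]; exact hscale _ k) (hdeg.trans_lt hcard)
  have := hQ 0
  rw [hQ0, Polynomial.eval_zero] at this
  simpa using this.symm

end BinaryForms

section Vanishing

/-- The pair interaction between the variables `x₁` and `x₂` with parameters `q₁` and `q₂`. -/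
noncomputable def pairFactor (p q₁ x₁ q₂ x₂ : ℂ) : ℂ :=
  q₂⁻¹ * (ellTheta (q₁ * q₂ * (x₁ * x₂)) p * ellTheta (q₂ * x₁ / (q₁ * x₂)) p) /
    (ellTheta (x₁ * x₂) p * ellTheta (x₁ / x₂) p)

/-- The product of all pair interactions. -/
noncomputable def pairProd {n : ℕ} (p : ℂ) (qq x : Fin n → ℂ) : ℂ :=
  ∏ i, ∏ j, if i < j then pairFactor p (qq i) (x i) (qq j) (x j) else 1

/-- The sum which vanishes under the balancing condition `a * b * ∏ i, qq i ^ 2 = 1`. -/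
noncomputable def vanishingSum {n : ℕ} (p : ℂ) (qq z : Fin n → ℂ) (a b : ℂ) : ℂ :=
  ∑ σ : Fin n → Bool,
    (∏ i, ellTheta (a * qq i * pw (z i) (σ i)) p * ellTheta (b * qq i * pw (z i) (σ i)) p /
      ellTheta (pw (z i) (σ i) ^ 2) p) * pairProd p qq fun i ↦ pw (z i) (σ i)

lemma pw_ne_zero {z : ℂ} (hz : z ≠ 0) (s : Bool) : pw z s ≠ 0 := by
  cases s <;> simp [pw, hz]

lemma pw_not (z : ℂ) (s : Bool) : pw z (!s) = (pw z s)⁻¹ := by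
  cases s <;> simp [pw]

lemma apply_pw_eq {f : ℂ → ℂ} {z : ℂ} (hf : f z⁻¹ = f z) (s : Bool) : f (pw z s) = f z := by
  cases s <;> simp [pw, hf]

lemma ellTheta_div_swap {p x y : ℂ} (hp1 : ‖p‖ < 1) (hx : x ≠ 0) (hy : y ≠ 0) :
    ellTheta (y / x) p = -(y / x) * ellTheta (x / y) p := by
  rw [← inv_div x y, ellTheta_inv hp1 (div_ne_zero hx hy)]

lemma ellTheta_mul_div_inv {p c x : ℂ} (hp1 : ‖p‖ < 1) (hc : c ≠ 0) (hx : x ≠ 0) :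
    ellTheta (x⁻¹ * c) p * ellTheta (x⁻¹ / c) p =
      (x ^ 2)⁻¹ * (ellTheta (x * c) p * ellTheta (x / c) p) := by
  have h1 : ellTheta (x⁻¹ * c) p = -(c / x) * ellTheta (x / c) p := by
    rw [← ellTheta_div_swap hp1 hx hc, div_eq_inv_mul]
  have h2 : ellTheta (x⁻¹ / c) p = -(x * c)⁻¹ * ellTheta (x * c) p := by
    rw [← ellTheta_inv hp1 (mul_ne_zero hx hc), mul_inv, div_eq_mul_inv]
  rw [h1, h2]
  field_simp

lemma pairFactor_comm {p q₁ x₁ q₂ x₂ : ℂ} (hp1 : ‖p‖ < 1) (hq₁ : q₁ ≠ 0) (hx₁ : x₁ ≠ 0)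
    (hq₂ : q₂ ≠ 0) (hx₂ : x₂ ≠ 0) : pairFactor p q₁ x₁ q₂ x₂ = pairFactor p q₂ x₂ q₁ x₁ := by
  unfold pairFactor
  rw [ellTheta_div_swap (x := x₁) (y := x₂) hp1 hx₁ hx₂,
    ellTheta_div_swap (x := q₂ * x₁) (y := q₁ * x₂) hp1 (mul_ne_zero hq₂ hx₁)
      (mul_ne_zero hq₁ hx₂), mul_comm q₂ q₁, mul_comm x₂ x₁]
  by_cases h : ellTheta (x₁ * x₂) p * ellTheta (x₁ / x₂) p = 0
  · rw [h, div_zero, show ellTheta (x₁ * x₂) p * (-(x₂ / x₁) * ellTheta (x₁ / x₂) p) =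
      -(x₂ / x₁) * (ellTheta (x₁ * x₂) p * ellTheta (x₁ / x₂) p) by ring, h, mul_zero, div_zero]
  · rw [← ne_eq, mul_ne_zero_iff] at h
    obtain ⟨h1, h2⟩ := h
    field_simp

lemma prod_lt_succAbove {M : Type*} [CommMonoid M] {n : ℕ} (g : Fin (n + 1) → Fin (n + 1) → M)
    (hg : ∀ i j, g i j = g j i) (k : Fin (n + 1)) :
    (∏ i, ∏ j, if i < j then g i j else 1) =
      (∏ i, g (k.succAbove i) k) *
        ∏ i, ∏ j, if i < j then g (k.succAbove i) (k.succAbove j) else 1 := by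
  rw [Fin.prod_univ_succAbove _ k, Fin.prod_univ_succAbove _ k]
  simp_rw [Fin.prod_univ_succAbove _ k, Fin.succAbove_lt_succAbove_iff, lt_irrefl, if_false,
    one_mul, Finset.prod_mul_distrib]
  rw [← mul_assoc, ← Finset.prod_mul_distrib]
  congr 1
  refine Finset.prod_congr rfl fun i _ ↦ ?_
  rcases lt_or_gt_of_ne (Fin.succAbove_ne k i) with h | h
  · rw [if_neg h.not_gt, if_pos h, one_mul]
  · rw [if_neg h.not_gt, if_pos h, mul_one, hg]

lemma pairProd_succAbove {n : ℕ} {p : ℂ} (hp1 : ‖p‖ < 1) {qq x : Fin (n + 1) → ℂ}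
    (hq : ∀ i, qq i ≠ 0) (hx : ∀ i, x i ≠ 0) (k : Fin (n + 1)) :
    pairProd p qq x =
      (∏ i, pairFactor p (qq (k.succAbove i)) (x (k.succAbove i)) (qq k) (x k)) *
        pairProd p (fun i ↦ qq (k.succAbove i)) (fun i ↦ x (k.succAbove i)) :=
  prod_lt_succAbove (fun i j ↦ pairFactor p (qq i) (x i) (qq j) (x j))
    (fun i j ↦ pairFactor_comm hp1 (hq i) (hx i) (hq j) (hx j)) k

lemma sum_insertNth {M : Type*} [AddCommMonoid M] {n : ℕ} (k : Fin (n + 1))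
    (f : (Fin (n + 1) → Bool) → M) :
    ∑ σ, f σ = ∑ s, ∑ τ : Fin n → Bool, f (k.insertNth (α := fun _ ↦ Bool) s τ) := by
  rw [← (Fin.insertNthEquiv (fun _ ↦ Bool) k).sum_comp, Fintype.sum_prod_type]
  rfl

/-- The product of a boundary factor and a pair interaction which occurs in the reduction of the
number of variables. -/
lemma exists_ellTheta_mul_pairFactor {p q₁ q₂ y z : ℂ} (hp1 : ‖p‖ < 1) (hq₁ : q₁ ≠ 0)
    (hq₂ : q₂ ≠ 0) (hy : y ≠ 0) (hz : z ≠ 0) : ∃ R : ℂ, ∀ s,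
      ellTheta (y / q₂ * q₁ * pw z s) p * pairFactor p q₁ (pw z s) q₂ y =
        R * ellTheta (q₂ * y * q₁ * pw z s) p := by
  have hc : y * q₁ / q₂ ≠ 0 := div_ne_zero (mul_ne_zero hy hq₁) hq₂
  set f : ℂ → ℂ := fun x ↦ q₂⁻¹ * (ellTheta (x * (y * q₁ / q₂)) p *
    ellTheta (x / (y * q₁ / q₂)) p) / (ellTheta (x * y) p * ellTheta (x / y) p) with hf
  have hinv : f z⁻¹ = f z := by
    have hz2 : (z ^ 2)⁻¹ ≠ 0 := inv_ne_zero (pow_ne_zero 2 hz)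
    simp only [hf]
    rw [ellTheta_mul_div_inv hp1 hc hz, ellTheta_mul_div_inv hp1 hy hz, mul_left_comm,
      mul_div_mul_left _ _ hz2]
  refine ⟨f z, fun s ↦ ?_⟩
  rw [← apply_pw_eq hinv s]
  simp only [hf, pairFactor]
  rw [show y / q₂ * q₁ * pw z s = pw z s * (y * q₁ / q₂) by ring,
    show q₂ * pw z s / (q₁ * y) = pw z s / (y * q₁ / q₂) by field_simp,
    show q₁ * q₂ * (pw z s * y) = q₂ * y * q₁ * pw z s by ring]
  ring

lemma vanishingSum_eq_zero_of_reduction {n : ℕ} {p : ℂ} (hp1 : ‖p‖ < 1)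
    {qq z : Fin (n + 1) → ℂ} (hq : ∀ i, qq i ≠ 0) (hz : ∀ i, z i ≠ 0) {a b : ℂ}
    (k : Fin (n + 1)) (s : Bool) (ha : a * qq k * pw (z k) s = 1)
    (h : vanishingSum p (fun i ↦ qq (k.succAbove i)) (fun i ↦ z (k.succAbove i))
      (qq k * pw (z k) (!s)) b = 0) :
    vanishingSum p qq z a b = 0 := by
  have hy := pw_ne_zero (hz k) (!s)
  have hay : a = pw (z k) (!s) / qq k := by
    rw [pw_not, eq_div_iff (hq k)]
    exact eq_inv_of_mul_eq_one_left ha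
  choose R hR using fun i ↦ exists_ellTheta_mul_pairFactor hp1 (hq (k.succAbove i)) (hq k) hy
    (hz (k.succAbove i))
  rw [vanishingSum, sum_insertNth k, Fintype.sum_eq_single (!s)]
  · rw [← mul_zero (ellTheta (a * qq k * pw (z k) (!s)) p *
      ellTheta (b * qq k * pw (z k) (!s)) p / ellTheta (pw (z k) (!s) ^ 2) p * ∏ i, R i), ← h,
      vanishingSum, Finset.mul_sum]
    refine Finset.sum_congr rfl fun τ _ ↦ ?_
    rw [Fin.prod_univ_succAbove _ k, pairProd_succAbove hp1 hq (fun i ↦ pw_ne_zero (hz i) _) k]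
    simp only [Fin.insertNth_apply_same, Fin.insertNth_apply_succAbove]
    have e : ∀ P Q T U V W : ℂ, T * U = V * W → P * T * (U * Q) = P * V * (W * Q) :=
      fun P Q T U V W h ↦ by linear_combination P * Q * h
    refine e _ _ _ _ _ _ ?_
    rw [← Finset.prod_mul_distrib, ← Finset.prod_mul_distrib]
    refine Finset.prod_congr rfl fun i _ ↦ ?_
    rw [hay]
    linear_combination ellTheta (b * qq (k.succAbove i) * pw (z (k.succAbove i)) (τ i)) p /
      ellTheta (pw (z (k.succAbove i)) (τ i) ^ 2) p * hR i (τ i)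
  · intro s' hs'
    obtain rfl : s' = s := by cases s <;> cases s' <;> simp_all
    refine Finset.sum_eq_zero fun τ _ ↦ ?_
    rw [Fin.prod_univ_succAbove _ k]
    simp [ha, ellTheta_one hp1]

lemma vanishingSum_one {p : ℂ} (hp1 : ‖p‖ < 1) {qq z : Fin 1 → ℂ} (hq : qq 0 ≠ 0)
    (hz : z 0 ≠ 0) {a b : ℂ} (h : a * b * ∏ i, qq i ^ 2 = 1) : vanishingSum p qq z a b = 0 := by
  rw [Fin.prod_univ_one] at h
  have ha : a ≠ 0 := fun h0 ↦ by simp [h0] at h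
  have hb : b ≠ 0 := fun h0 ↦ by simp [h0] at h
  have h1 : ellTheta (b * qq 0 * (z 0)⁻¹) p =
      -(a * qq 0 * z 0)⁻¹ * ellTheta (a * qq 0 * z 0) p := by
    rw [← ellTheta_inv hp1 (mul_ne_zero (mul_ne_zero ha hq) hz)]
    congr 1
    refine eq_inv_of_mul_eq_one_left ?_
    field_simp
    linear_combination h
  have h2 : ellTheta (a * qq 0 * (z 0)⁻¹) p =
      -(b * qq 0 * z 0)⁻¹ * ellTheta (b * qq 0 * z 0) p := by
    rw [← ellTheta_inv hp1 (mul_ne_zero (mul_ne_zero hb hq) hz)]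
    congr 1
    refine eq_inv_of_mul_eq_one_left ?_
    field_simp
    linear_combination h
  have h3 : ellTheta ((z 0)⁻¹ ^ 2) p = -(z 0 ^ 2)⁻¹ * ellTheta (z 0 ^ 2) p := by
    rw [inv_pow, ellTheta_inv hp1 (pow_ne_zero 2 hz)]
  rw [vanishingSum, sum_insertNth 0]
  simp only [pairProd, Fintype.sum_bool, Finset.univ_unique, Finset.prod_singleton,
    Finset.sum_singleton, Fin.default_eq_zero, Fin.insertNth_apply_same, pw, if_true, lt_irrefl,
    if_false, mul_one, Bool.false_eq_true, h1, h2, h3]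
  by_cases hθ : ellTheta (z 0 ^ 2) p = 0
  · simp [hθ]
  · field_simp
    linear_combination ellTheta (a * qq 0 * z 0) p * ellTheta (qq 0 * z 0 * b) p * h

/-- The inductive step under a genericity assumption on the parameters. -/
lemma vanishingSum_eq_zero_of_forall_ne {n : ℕ} {p : ℂ} (hp0 : p ≠ 0) (hp1 : ‖p‖ < 1)
    (IH : ∀ (qq z : Fin n → ℂ) (a b : ℂ), (∀ i, qq i ≠ 0) → (∀ i, z i ≠ 0) →
      (∀ i, ellTheta (z i ^ 2) p ≠ 0) → a * b * ∏ i, qq i ^ 2 = 1 → vanishingSum p qq z a b = 0)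
    {qq z : Fin (n + 1) → ℂ} {a b : ℂ} (hq : ∀ i, qq i ≠ 0) (hz : ∀ i, z i ≠ 0)
    (hz2 : ∀ i, ellTheta (z i ^ 2) p ≠ 0) (h : a * b * ∏ i, qq i ^ 2 = 1)
    (hgen : ∀ k l : Fin (n + 1) × Bool, k ≠ l →
      ellTheta (a * b * (qq k.1 * pw (z k.1) k.2 * (qq l.1 * pw (z l.1) l.2))) p ≠ 0 ∧
      ellTheta (qq k.1 * pw (z k.1) k.2 / (qq l.1 * pw (z l.1) l.2)) p ≠ 0) :
    vanishingSum p qq z a b = 0 := by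
  have ha : a ≠ 0 := fun h0 ↦ by simp [h0] at h
  have hb : b ≠ 0 := fun h0 ↦ by simp [h0] at h
  obtain ⟨κ, E, O, hκ, hEO⟩ := exists_ellTheta_mul_eq hp0 hp1
  obtain ⟨c, hc⟩ : ∃ c, a * b = c ^ 2 :=
    (IsAlgClosed.exists_pow_nat_eq (a * b) two_pos).imp fun _ ↦ Eq.symm
  have hc0 : c ≠ 0 := fun h0 ↦ mul_ne_zero ha hb (by rw [hc, h0]; ring)
  set X : Fin (n + 1) × Bool → ℂ := fun k ↦ c * (qq k.1 * pw (z k.1) k.2) with hX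
  have hX0 : ∀ k, X k ≠ 0 := fun k ↦
    mul_ne_zero hc0 (mul_ne_zero (hq _) (pw_ne_zero (hz _) _))
  have hexp : ∀ y : ℂ, y ≠ 0 → vanishingSum p qq z (c * y) (c / y) =
      ∑ σ : Fin (n + 1) → Bool, ((∏ i, X (i, σ i) / (κ * ellTheta (pw (z i) (σ i) ^ 2) p)) *
        pairProd p qq fun i ↦ pw (z i) (σ i)) *
        ∏ i, (O (X (i, σ i)) * E y + -E (X (i, σ i)) * O y) := by
    intro y hy
    refine Finset.sum_congr rfl fun σ _ ↦ ?_
    rw [mul_right_comm, ← Finset.prod_mul_distrib]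
    congr 1
    refine Finset.prod_congr rfl fun i _ ↦ ?_
    have := hEO (X (i, σ i)) y (hX0 _) hy
    rw [div_mul_eq_mul_div (X (i, σ i)),
      show X (i, σ i) * (O (X (i, σ i)) * E y + -E (X (i, σ i)) * O y) =
        X (i, σ i) * (O (X (i, σ i)) * E y - E (X (i, σ i)) * O y) by ring, ← this,
      mul_div_mul_left _ _ hκ]
    simp only [hX]
    congr 3 <;> ring
  have hzero : ∀ k, vanishingSum p qq z (c * (X k)⁻¹) (c / (X k)⁻¹) = 0 := by
    intro k
    have hx := pw_ne_zero (hz k.1) k.2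
    have hqk := hq k.1
    refine vanishingSum_eq_zero_of_reduction hp1 hq hz k.1 k.2 ?_ (IH _ _ _ _ (fun i ↦ hq _)
      (fun i ↦ hz _) (fun i ↦ hz2 _) ?_)
    · simp only [hX]
      field_simp
    · rw [← h, Fin.prod_univ_succAbove _ k.1, hc, pw_not]
      simp only [hX]
      field_simp
  have key := sum_prod_linear_eq_zero (by simp) (fun σ : Fin (n + 1) → Bool ↦
      (∏ i, X (i, σ i) / (κ * ellTheta (pw (z i) (σ i) ^ 2) p)) *
        pairProd p qq fun i ↦ pw (z i) (σ i))
    (fun σ i ↦ O (X (i, σ i))) (fun σ i ↦ -E (X (i, σ i)))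
    (fun k ↦ E (X k)⁻¹) (fun k ↦ O (X k)⁻¹) (fun k l hkl ↦ ?_)
    (fun k ↦ by rw [← hexp _ (inv_ne_zero (hX0 k)), hzero]) (E (a / c)) (O (a / c))
  · rw [← hexp _ (div_ne_zero ha hc0), mul_div_cancel₀ _ hc0] at key
    rw [← key]
    congr 1
    field_simp
    linear_combination hc
  · have hPQ := hEO (X k)⁻¹ (X l)⁻¹ (inv_ne_zero (hX0 k)) (inv_ne_zero (hX0 l))
    intro h0
    have hne : κ * (ellTheta ((X k)⁻¹ * (X l)⁻¹) p * ellTheta ((X k)⁻¹ / (X l)⁻¹) p) ≠ 0 := by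
      refine mul_ne_zero hκ (mul_ne_zero ?_ ?_)
      · rw [← mul_inv]
        refine ellTheta_inv_ne_zero hp1 (mul_ne_zero (hX0 k) (hX0 l)) ?_
        convert (hgen k l hkl).1 using 2
        simp only [hX]
        rw [hc]
        ring
      · convert (hgen l k hkl.symm).2 using 2
        simp only [hX]
        rw [inv_div_inv, mul_div_mul_left _ _ hc0]
    refine hne (hPQ.trans ?_)
    linear_combination (-(X k)⁻¹) * h0

lemma ofReal_exp_add (x y : ℝ) : (Real.exp (x + y) : ℂ) = Real.exp x * Real.exp y := by
  rw [Real.exp_add, Complex.ofReal_mul]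

lemma continuous_pairProd {n : ℕ} {p : ℂ} (hp1 : ‖p‖ < 1) {Q : ℝ → Fin n → ℂ} {x : Fin n → ℂ}
    (hQ : ∀ i, Continuous fun r ↦ Q r i) (hQ0 : ∀ r i, Q r i ≠ 0) (hx : ∀ i, x i ≠ 0) :
    Continuous fun r ↦ pairProd p (Q r) x := by
  unfold pairProd
  refine continuous_finsetProd _ fun i _ ↦ continuous_finsetProd _ fun j _ ↦ ?_
  split_ifs
  · unfold pairFactor
    refine (((hQ j).inv₀ fun r ↦ hQ0 r j).mul ((continuous_ellTheta_comp hp1 (((hQ i).mul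
      (hQ j)).mul_const _) fun r ↦ ?_).mul (continuous_ellTheta_comp hp1 (((hQ j).mul_const _).div₀
        ((hQ i).mul_const _) fun r ↦ ?_) fun r ↦ ?_))).div_const _
    · exact mul_ne_zero (mul_ne_zero (hQ0 r i) (hQ0 r j)) (mul_ne_zero (hx i) (hx j))
    · exact mul_ne_zero (hQ0 r i) (hx j)
    · exact div_ne_zero (mul_ne_zero (hQ0 r j) (hx i)) (mul_ne_zero (hQ0 r i) (hx j))
  · exact continuous_const

lemma continuous_vanishingSum {n : ℕ} {p : ℂ} (hp1 : ‖p‖ < 1) {Q : ℝ → Fin n → ℂ}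
    {z : Fin n → ℂ} {a b : ℝ → ℂ} (hQ : ∀ i, Continuous fun r ↦ Q r i) (hQ0 : ∀ r i, Q r i ≠ 0)
    (hz : ∀ i, z i ≠ 0) (ha : Continuous a) (ha0 : ∀ r, a r ≠ 0) (hb : Continuous b)
    (hb0 : ∀ r, b r ≠ 0) : Continuous fun r ↦ vanishingSum p (Q r) z (a r) (b r) := by
  unfold vanishingSum
  refine continuous_finsetSum _ fun σ _ ↦ (continuous_finsetProd _ fun i _ ↦ ?_).mul
    (continuous_pairProd hp1 hQ hQ0 fun i ↦ pw_ne_zero (hz i) _)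
  refine ((continuous_ellTheta_comp hp1 ((ha.mul (hQ i)).mul_const _) fun r ↦ ?_).mul
    (continuous_ellTheta_comp hp1 ((hb.mul (hQ i)).mul_const _) fun r ↦ ?_)).div_const _
  · exact mul_ne_zero (mul_ne_zero (ha0 r) (hQ0 r i)) (pw_ne_zero (hz i) _)
  · exact mul_ne_zero (mul_ne_zero (hb0 r) (hQ0 r i)) (pw_ne_zero (hz i) _)

/-- A signed theta sum in at least one variable vanishes under the balancing condition. -/
theorem vanishingSum_eq_zero {p : ℂ} (hp0 : p ≠ 0) (hp1 : ‖p‖ < 1) (n : ℕ) :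
    ∀ (qq z : Fin (n + 1) → ℂ) (a b : ℂ), (∀ i, qq i ≠ 0) → (∀ i, z i ≠ 0) →
      (∀ i, ellTheta (z i ^ 2) p ≠ 0) → a * b * ∏ i, qq i ^ 2 = 1 →
      vanishingSum p qq z a b = 0 := by
  induction n with
  | zero => exact fun qq z a b hq hz _ h ↦ vanishingSum_one hp1 (hq 0) (hz 0) h
  | succ n IH =>
    intro qq z a b hq hz hz2 h
    have ha : a ≠ 0 := fun h0 ↦ by simp [h0] at h
    have hb : b ≠ 0 := fun h0 ↦ by simp [h0] at h
    have hE : ∀ x : ℝ, (Real.exp x : ℂ) ≠ 0 := fun x ↦ by exact_mod_cast (Real.exp_pos x).ne'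
    set wt : Fin (n + 2) → ℝ := fun i ↦ (i : ℝ) + 1 with hwt
    have hwt0 : ∀ i, 0 < wt i := fun i ↦ by simp only [hwt]; positivity
    set M : ℝ := ∑ i, wt i with hM
    have hlt : ∀ i, wt i < M := by
      intro i
      obtain ⟨j, hj⟩ := exists_ne i
      exact Finset.single_lt_sum hj (Finset.mem_univ i) (Finset.mem_univ j) (hwt0 j)
        fun k _ _ ↦ (hwt0 k).le
    set Q : ℝ → Fin (n + 2) → ℂ := fun r i ↦ qq i * (Real.exp (wt i * r) : ℂ) with hQdef
    set B : ℝ → ℂ := fun r ↦ b * (Real.exp (-(2 * M) * r) : ℂ) with hBdef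
    have hQ : ∀ i, Continuous fun r ↦ Q r i := fun i ↦ by simp only [hQdef]; fun_prop
    have hQ0 : ∀ r i, Q r i ≠ 0 := fun r i ↦ mul_ne_zero (hq i) (hE _)
    have hB : Continuous B := by simp only [hBdef]; fun_prop
    have hB0 : ∀ r, B r ≠ 0 := fun r ↦ mul_ne_zero hb (hE _)
    set x : Fin (n + 2) × Bool → ℂ := fun k ↦ qq k.1 * pw (z k.1) k.2 with hx
    have hx0 : ∀ k, x k ≠ 0 := fun k ↦ mul_ne_zero (hq _) (pw_ne_zero (hz _) _)
    have hF := eq_zero_of_generic hp1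
      (K := {kl : (Fin (n + 2) × Bool) × (Fin (n + 2) × Bool) // kl.1 ≠ kl.2} × Bool)
      (fun k ↦ if k.2 then a * b * (x k.1.1.1 * x k.1.1.2) else x k.1.1.1 / x k.1.1.2)
      (fun k ↦ if k.2 then wt k.1.1.1.1 + wt k.1.1.2.1 - 2 * M else wt k.1.1.1.1 - wt k.1.1.2.1)
      ?_ ?_
      (continuous_vanishingSum hp1 hQ hQ0 hz (continuous_const (y := a)) (fun _ ↦ ha) hB hB0) ?_
    · simpa [hQdef, hBdef] using hF
    · rintro ⟨⟨⟨k, l⟩, hkl⟩, _ | _⟩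
      · simpa using ⟨hx0 k, hx0 l⟩
      · simpa using ⟨⟨ha, hb⟩, hx0 k, hx0 l⟩
    · rintro ⟨⟨⟨⟨i, s⟩, ⟨j, t⟩⟩, hkl⟩, _ | _⟩
      · by_cases hij : i = j
        · subst hij
          refine Or.inr ?_
          have hst : s ≠ t := fun hst ↦ hkl (by rw [hst])
          simp only [hx, Bool.false_eq_true, if_false]
          rw [mul_div_mul_left _ _ (hq i)]
          cases s <;> cases t <;> simp only [ne_eq, not_true_eq_false, pw] at hst ⊢
          · simp only [Bool.false_eq_true, if_false, if_true]
            rw [show (z i)⁻¹ / z i = (z i ^ 2)⁻¹ by field_simp]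
            exact ellTheta_inv_ne_zero hp1 (pow_ne_zero 2 (hz i)) (hz2 i)
          · simp only [Bool.false_eq_true, if_false, if_true]
            rw [show z i / (z i)⁻¹ = z i ^ 2 by field_simp]
            exact hz2 i
        · refine Or.inl ?_
          simp only [hwt, Bool.false_eq_true, if_false]
          intro h0
          refine hij (Fin.ext ?_)
          have : (i : ℝ) = j := by linarith
          exact_mod_cast this
      · refine Or.inl ?_
        simp only [if_true]
        have := hlt i
        have := hlt j
        linarith
    · intro r hr
      refine vanishingSum_eq_zero_of_forall_ne hp0 hp1 IH (hQ0 r) hz hz2 ?_ fun k l hkl ↦ ?_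
      · have hprod : ∏ i, Q r i ^ 2 = (∏ i, qq i ^ 2) * (Real.exp (2 * M * r) : ℂ) := by
          simp only [hQdef, mul_pow, Finset.prod_mul_distrib]
          congr 1
          rw [hM, Finset.mul_sum, Finset.sum_mul, Real.exp_sum, Complex.ofReal_prod]
          refine Finset.prod_congr rfl fun i _ ↦ ?_
          rw [← Complex.ofReal_pow, ← Real.exp_nat_mul]
          congr 2
          push_cast
          ring
        have hc : (Real.exp (-(2 * M) * r) : ℂ) * Real.exp (2 * M * r) = 1 := by
          rw [← ofReal_exp_add]; simp
        rw [hprod]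
        simp only [hBdef]
        linear_combination (Real.exp (-(2 * M) * r) : ℂ) * Real.exp (2 * M * r) * h + hc
      · refine ⟨?_, ?_⟩
        · have := hr (⟨(k, l), hkl⟩, true)
          convert this using 2
          simp only [hBdef, hQdef, hx, if_true]
          rw [show (wt k.1 + wt l.1 - 2 * M) * r = wt k.1 * r + (wt l.1 * r + -(2 * M) * r) by ring,
            ofReal_exp_add, ofReal_exp_add]
          ring
        · have := hr (⟨(k, l), hkl⟩, false)
          convert this using 2
          simp only [hQdef, hx, Bool.false_eq_true, if_false]
          have he := hE (wt l.1 * r)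
          have h1 : (Real.exp (wt k.1 * r) : ℂ) =
              Real.exp ((wt k.1 - wt l.1) * r) * Real.exp (wt l.1 * r) := by
            rw [← ofReal_exp_add]; congr 2; ring
          have hq1 := hq l.1
          have hx1 := pw_ne_zero (hz l.1) l.2
          rw [h1]
          field_simp

end Vanishing

section Symmetry

/-- The sum over signs in `Ssum`, without its prefactor. -/
noncomputable def signedSum {n : ℕ} (p : ℂ) (qq z : Fin n → ℂ) (t u v w : ℂ) : ℂ :=
  ∑ σ : Fin n → Bool,
    (∏ i, ellTheta (t * pw (z i) (σ i) / qq i) p * ellTheta (u * qq i * pw (z i) (σ i)) p *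
        ellTheta (v * qq i * pw (z i) (σ i)) p * ellTheta (w * qq i * pw (z i) (σ i)) p /
        (pw (z i) (σ i) * ellTheta (pw (z i) (σ i) ^ 2) p)) *
      pairProd p qq fun i ↦ pw (z i) (σ i)

lemma Ssum_eq {n : ℕ} (p : ℂ) (qq z : Fin n → ℂ) (t u v w : ℂ) :
    Ssum n p qq z t u v w =
      t * (ellTheta (u * v) p * ellTheta (u * w) p * ellTheta (v * w) p) *
        signedSum p qq z t u v w := rfl

lemma exists_pairFactor_eq {p q Q y z : ℂ} (hp1 : ‖p‖ < 1) (hQ : Q ≠ 0)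
    (hy : y ≠ 0) (hz : z ≠ 0) (h₁ : ellTheta (z * y) p ≠ 0) (h₂ : ellTheta (z / y) p ≠ 0) :
    ∃ K : ℂ, K ≠ 0 ∧ ∀ s s', pairFactor p q (pw z s) Q (pw y s') =
      K * (ellTheta (Q / pw y s' * pw z s / q) p * ellTheta (Q * pw y s' * q * pw z s) p /
        pw z s) := by
  set f : ℂ → ℂ := fun x ↦ ellTheta (x * y) p * ellTheta (x / y) p / x with hf
  have hinv : f z⁻¹ = f z := by
    simp only [hf]
    rw [ellTheta_mul_div_inv hp1 hy hz]
    field_simp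
  have hf0 : f z ≠ 0 := div_ne_zero (mul_ne_zero h₁ h₂) hz
  refine ⟨Q⁻¹ / f z, div_ne_zero (inv_ne_zero hQ) hf0, fun s s' ↦ ?_⟩
  have hx := pw_ne_zero hz s
  have hden : ellTheta (pw z s * pw y s') p * ellTheta (pw z s / pw y s') p = f z * pw z s := by
    rw [← apply_pw_eq hinv s]
    simp only [hf]
    rw [div_mul_cancel₀ _ hx]
    cases s'
    · simp [pw, div_eq_mul_inv, mul_comm]
    · simp [pw]
  rw [pairFactor, hden, show q * Q * (pw z s * pw y s') = Q * pw y s' * q * pw z s by ring,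
    show Q * pw z s / (q * pw y s') = Q / pw y s' * pw z s / q by
      rw [div_mul_eq_mul_div, div_div, mul_comm q]]
  field_simp

lemma Ssum_swap_of_ne {n : ℕ} {p : ℂ} (hp0 : p ≠ 0) (hp1 : ‖p‖ < 1) {qq z : Fin n → ℂ}
    {Q y v w : ℂ} (hQ : Q ≠ 0) (hy : y ≠ 0) (hq : ∀ i, qq i ≠ 0) (hz : ∀ i, z i ≠ 0)
    (hz2 : ∀ i, ellTheta (z i ^ 2) p ≠ 0) (hbal : v * w * (Q ^ 2 * ∏ i, qq i ^ 2) = 1)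
    (hy2 : ellTheta (y ^ 2) p ≠ 0) (h₁ : ∀ i, ellTheta (z i * y) p ≠ 0)
    (h₂ : ∀ i, ellTheta (z i / y) p ≠ 0) :
    Ssum n p qq z (Q / y) (Q * y) v w = Ssum n p qq z (Q * y) (Q / y) v w := by
  have hq' : ∀ i, (Fin.cons Q qq : Fin (n + 1) → ℂ) i ≠ 0 := Fin.cases hQ hq
  have hz' : ∀ i, (Fin.cons y z : Fin (n + 1) → ℂ) i ≠ 0 := Fin.cases hy hz
  have hvan := vanishingSum_eq_zero hp0 hp1 n (Fin.cons Q qq) (Fin.cons y z) v w hq' hz'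
    (Fin.cases hy2 hz2) (by simpa [Fin.prod_univ_succ] using hbal)
  choose K hK0 hK using fun i ↦ exists_pairFactor_eq (q := qq i) hp1 hQ hy (hz i) (h₁ i) (h₂ i)
  have hterm : vanishingSum p (Fin.cons Q qq : Fin (n + 1) → ℂ) (Fin.cons y z) v w =
      ∑ s, ellTheta (v * Q * pw y s) p * ellTheta (w * Q * pw y s) p / ellTheta (pw y s ^ 2) p *
        (∏ i, K i) * signedSum p qq z (Q / pw y s) (Q * pw y s) v w := by
    rw [vanishingSum, sum_insertNth 0]
    refine Finset.sum_congr rfl fun s _ ↦ ?_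
    rw [signedSum, Finset.mul_sum]
    refine Finset.sum_congr rfl fun τ _ ↦ ?_
    rw [Fin.prod_univ_succAbove _ 0, pairProd_succAbove hp1 hq' (fun i ↦ pw_ne_zero (hz' i) _) 0]
    simp only [Fin.insertNth_apply_same, Fin.zero_succAbove, Fin.cons_zero, Fin.cons_succ,
      Fin.insertNth_zero', hK]
    have e : ∀ P A U R V W : ℂ, A * U = V * W → P * A * (U * R) = P * V * (W * R) :=
      fun P A U R V W h ↦ by linear_combination P * R * h
    refine e _ _ _ _ _ _ ?_
    rw [← Finset.prod_mul_distrib, ← Finset.prod_mul_distrib]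
    refine Finset.prod_congr rfl fun i _ ↦ ?_
    rw [← div_div]
    ring
  rw [hterm, Fintype.sum_bool] at hvan
  simp only [pw, if_true, Bool.false_eq_true, if_false, inv_pow, div_inv_eq_mul] at hvan
  rw [ellTheta_inv hp1 (pow_ne_zero 2 hy)] at hvan
  have hK' : ∏ i, K i ≠ 0 := Finset.prod_ne_zero_iff.mpr fun i _ ↦ hK0 i
  rw [Ssum_eq, Ssum_eq, show Q * y * v = v * Q * y by ring, show Q * y * w = w * Q * y by ring,
    show Q / y * v = v * Q * y⁻¹ by ring, show Q / y * w = w * Q * y⁻¹ by ring]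
  rw [← div_eq_mul_inv Q y] at hvan
  generalize signedSum p qq z (Q / y) (Q * y) v w = S₁ at hvan ⊢
  generalize signedSum p qq z (Q * y) (Q / y) v w = S₂ at hvan ⊢
  generalize ellTheta (v * Q * y⁻¹) p = T₁ at hvan ⊢
  generalize ellTheta (w * Q * y⁻¹) p = T₂ at hvan ⊢
  generalize ellTheta (v * Q * y) p = T₃ at hvan ⊢
  generalize ellTheta (w * Q * y) p = T₄ at hvan ⊢
  generalize ∏ i, K i = κ at hvan hK'
  generalize ellTheta (y ^ 2) p = Y at hvan hy2
  have key : T₃ * T₄ * S₁ = y ^ 2 * (T₁ * T₂ * S₂) := by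
    field_simp at hvan
    refine mul_left_cancel₀ hK' ?_
    linear_combination hvan
  field_simp
  linear_combination ellTheta (v * w) p * key

lemma continuous_Ssum {n : ℕ} {p : ℂ} (hp1 : ‖p‖ < 1) {qq z : Fin n → ℂ} {t u : ℝ → ℂ} {v w : ℂ}
    (hq : ∀ i, qq i ≠ 0) (hz : ∀ i, z i ≠ 0) (ht : Continuous t) (ht0 : ∀ r, t r ≠ 0)
    (hu : Continuous u) (hu0 : ∀ r, u r ≠ 0) (hv : v ≠ 0) (hw : w ≠ 0) :
    Continuous fun r ↦ Ssum n p qq z (t r) (u r) v w := by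
  simp only [Ssum_eq, signedSum]
  refine (ht.mul (((continuous_ellTheta_comp hp1 (hu.mul_const v)
    fun r ↦ mul_ne_zero (hu0 r) hv).mul
    (continuous_ellTheta_comp hp1 (hu.mul_const w) fun r ↦ mul_ne_zero (hu0 r) hw)).mul_const _)).mul
    (continuous_finsetSum _ fun σ _ ↦ (continuous_finsetProd _ fun i _ ↦ ?_).mul_const _)
  have hx := pw_ne_zero (hz i) (σ i)
  exact ((((continuous_ellTheta_comp hp1 ((ht.mul_const _).div_const _) fun r ↦
    div_ne_zero (mul_ne_zero (ht0 r) hx) (hq i)).mul (continuous_ellTheta_comp hp1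
      ((hu.mul_const _).mul_const _) fun r ↦ mul_ne_zero (mul_ne_zero (hu0 r) (hq i)) hx)).mul_const
        _).mul_const _).div_const _

lemma Ssum_swap {n : ℕ} {p : ℂ} (hp0 : p ≠ 0) (hp1 : ‖p‖ < 1) {qq z : Fin n → ℂ}
    {t u v w : ℂ} (ht : t ≠ 0) (hu : u ≠ 0) (hv : v ≠ 0) (hw : w ≠ 0) (hq : ∀ i, qq i ≠ 0)
    (hz : ∀ i, z i ≠ 0) (hz2 : ∀ i, ellTheta (z i ^ 2) p ≠ 0)
    (hbal : t * u * v * w * ∏ i, qq i ^ 2 = 1) :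
    Ssum n p qq z t u v w = Ssum n p qq z u t v w := by
  have hE : ∀ x : ℝ, (Real.exp x : ℂ) ≠ 0 := fun x ↦ by exact_mod_cast (Real.exp_pos x).ne'
  obtain ⟨Q, hQ⟩ := IsAlgClosed.exists_pow_nat_eq (t * u) two_pos
  have hQ0 : Q ≠ 0 := fun h0 ↦ mul_ne_zero ht hu (by rw [← hQ, h0]; ring)
  have hy : u / Q ≠ 0 := div_ne_zero hu hQ0
  have hF := eq_zero_of_generic hp1
    (F := fun r ↦ Ssum n p qq z (t * (Real.exp (-r) : ℂ)) (u * (Real.exp r : ℂ)) v w -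
      Ssum n p qq z (u * (Real.exp r : ℂ)) (t * (Real.exp (-r) : ℂ)) v w)
    (fun k : Option (Fin n × Bool) ↦ k.elim ((u / Q) ^ 2) fun i ↦
      if i.2 then z i.1 * (u / Q) else z i.1 / (u / Q))
    (fun k ↦ k.elim 2 fun i ↦ if i.2 then 1 else -1) ?_ ?_ ?_ ?_
  · simpa [sub_eq_zero] using hF
  · rintro (_ | ⟨i, _ | _⟩)
    · exact pow_ne_zero 2 hy
    · exact div_ne_zero (hz i) hy
    · exact mul_ne_zero (hz i) hy
  · rintro (_ | ⟨i, _ | _⟩) <;> simp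
  · have h1 : Continuous fun r : ℝ ↦ t * (Real.exp (-r) : ℂ) := by fun_prop
    have h2 : Continuous fun r : ℝ ↦ u * (Real.exp r : ℂ) := by fun_prop
    have h3 : ∀ r : ℝ, t * (Real.exp (-r) : ℂ) ≠ 0 := fun r ↦ mul_ne_zero ht (hE _)
    have h4 : ∀ r : ℝ, u * (Real.exp r : ℂ) ≠ 0 := fun r ↦ mul_ne_zero hu (hE _)
    exact (continuous_Ssum hp1 hq hz h1 h3 h2 h4 hv hw).sub
      (continuous_Ssum hp1 hq hz h2 h4 h1 h3 hv hw)
  · intro r hr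
    have he := hE r
    have hneg : (Real.exp (-r) : ℂ) = (Real.exp r : ℂ)⁻¹ := by
      rw [Real.exp_neg, Complex.ofReal_inv]
    have := Ssum_swap_of_ne hp0 hp1 hQ0 (mul_ne_zero hy (hE r)) hq hz hz2 (v := v) (w := w)
      (by rw [hQ]; linear_combination hbal) ?_ (fun i ↦ ?_) (fun i ↦ ?_)
    · rw [show t * (Real.exp (-r) : ℂ) = Q / (u / Q * Real.exp r) by
          rw [hneg]; field_simp; exact hQ.symm,
        show u * (Real.exp r : ℂ) = Q * (u / Q * Real.exp r) by field_simp, this, sub_self]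
    · convert hr none using 2
      simp only [Option.elim]
      rw [mul_pow, ← Complex.ofReal_pow, ← Real.exp_nat_mul]
      norm_num
    · convert hr (some (i, true)) using 2
      simp [mul_assoc]
    · convert hr (some (i, false)) using 2
      simp only [Option.elim, Bool.false_eq_true, if_false, neg_one_mul, hneg]
      field_simp

lemma Ssum_swap_middle {n : ℕ} (p : ℂ) (qq z : Fin n → ℂ) (t u v w : ℂ) :
    Ssum n p qq z t u v w = Ssum n p qq z t v u w := by
  rw [Ssum_eq, Ssum_eq, mul_comm u v]
  congr 1
  · ring
  · refine Finset.sum_congr rfl fun σ _ ↦ ?_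
    congr 1
    exact Finset.prod_congr rfl fun i _ ↦ by ring

lemma Ssum_swap_last {n : ℕ} (p : ℂ) (qq z : Fin n → ℂ) (t u v w : ℂ) :
    Ssum n p qq z t u v w = Ssum n p qq z t u w v := by
  rw [Ssum_eq, Ssum_eq, mul_comm v w]
  congr 1
  · ring
  · refine Finset.sum_congr rfl fun σ _ ↦ ?_
    congr 1
    exact Finset.prod_congr rfl fun i _ ↦ by ring

lemma apply_eq_of_triple_eq {α β : Type*} {f : α → α → α → β}
    (h₁ : ∀ a b c, f a b c = f b a c) (h₂ : ∀ a b c, f a b c = f a c b) {a b c a' b' c' : α}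
    (h : ({a', b', c'} : Multiset α) = {a, b, c}) : f a' b' c' = f a b c := by
  have pair : ∀ {a b c b' c' : α}, ({b', c'} : Multiset α) = {b, c} → f a b' c' = f a b c := by
    intro a b c b' c' h
    have hb : b' ∈ ({b, c} : Multiset α) := h ▸ Multiset.mem_cons_self _ _
    simp only [Multiset.insert_eq_cons, Multiset.mem_cons, Multiset.mem_singleton] at h hb
    rcases hb with rfl | rfl
    · rw [Multiset.singleton_inj.mp ((Multiset.cons_inj_right _).mp h)]
    · rw [← Multiset.insert_eq_cons b, Multiset.pair_comm b, Multiset.insert_eq_cons] at h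
      rw [Multiset.singleton_inj.mp ((Multiset.cons_inj_right _).mp h), h₂]
  have ha : a' ∈ ({a, b, c} : Multiset α) := h ▸ Multiset.mem_cons_self _ _
  simp only [Multiset.insert_eq_cons, Multiset.mem_cons, Multiset.mem_singleton] at h ha
  rcases ha with rfl | rfl | rfl
  · exact pair ((Multiset.cons_inj_right _).mp h)
  · rw [Multiset.cons_swap a] at h
    rw [pair ((Multiset.cons_inj_right _).mp h), h₁]
  · rw [← Multiset.insert_eq_cons b, Multiset.pair_comm b, Multiset.insert_eq_cons,
      Multiset.cons_swap a] at h
    rw [pair ((Multiset.cons_inj_right _).mp h), h₁, h₂]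

end Symmetry

/-- Corollary: `S(t,u,v,w)` is symmetric under permutations of `t,u,v,w`. -/
theorem Ssum_symmetric (n : ℕ) (hn : 1 ≤ n) (p : ℂ)
    (hp0 : 0 < ‖p‖) (hp1 : ‖p‖ < 1)
    (t u v w : ℂ) (qq z : Fin n → ℂ)
    (ht0 : t ≠ 0) (hu0 : u ≠ 0) (hv0 : v ≠ 0) (hw0 : w ≠ 0)
    (hq0 : ∀ i, qq i ≠ 0) (hz0 : ∀ i, z i ≠ 0)
    (hbal : t * u * v * w * ∏ i, qq i ^ 2 = 1)
    (hz2 : ∀ i, ellTheta (z i ^ 2) p ≠ 0)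
    (hzij : ∀ i j, i < j → ellTheta (z i * z j) p ≠ 0 ∧ ellTheta (z i / z j) p ≠ 0) :
    ∀ t' u' v' w' : ℂ, ({t', u', v', w'} : Multiset ℂ) = ({t, u, v, w} : Multiset ℂ) →
      Ssum n p qq z t' u' v' w' = Ssum n p qq z t u v w := by
  intro t' u' v' w' h
  have hp : p ≠ 0 := norm_pos_iff.mp hp0
  have triple : ∀ {s a b c a' b' c' : ℂ}, ({a', b', c'} : Multiset ℂ) = {a, b, c} →
      Ssum n p qq z s a' b' c' = Ssum n p qq z s a b c := fun {s} _ _ _ _ _ _ h ↦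
    apply_eq_of_triple_eq (f := Ssum n p qq z s) (Ssum_swap_middle p qq z s)
      (Ssum_swap_last p qq z s) h
  have ht : t' ∈ ({t, u, v, w} : Multiset ℂ) := h ▸ Multiset.mem_cons_self _ _
  simp only [Multiset.insert_eq_cons, Multiset.mem_cons, Multiset.mem_singleton] at h ht
  rcases ht with rfl | rfl | rfl | rfl
  · exact triple ((Multiset.cons_inj_right _).mp h)
  · rw [Multiset.cons_swap t] at h
    rw [triple ((Multiset.cons_inj_right _).mp h)]
    exact Ssum_swap hp hp1 hu0 ht0 hv0 hw0 hq0 hz0 hz2 (by linear_combination hbal)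
  · rw [Multiset.cons_swap u, Multiset.cons_swap t] at h
    rw [triple ((Multiset.cons_inj_right _).mp h), Ssum_swap_middle p qq z t u]
    exact Ssum_swap hp hp1 hv0 ht0 hu0 hw0 hq0 hz0 hz2 (by linear_combination hbal)
  · rw [← Multiset.insert_eq_cons v, Multiset.pair_comm v, Multiset.insert_eq_cons,
      Multiset.cons_swap u, Multiset.cons_swap t] at h
    rw [triple ((Multiset.cons_inj_right _).mp h), Ssum_swap_last p qq z t u,
      Ssum_swap_middle p qq z t u]
    exact Ssum_swap hp hp1 hw0 ht0 hu0 hv0 hq0 hz0 hz2 (by linear_combination hbal)
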